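/- Sure success of the interval Jacobian test with Lipschitz box forms: Let B ⊆ ℝⁿ be a box of width w > 0, let f : ℝⁿ → ℝⁿ be twice continuously differentiable, and let α ∈ B be a simple zero of f. Set U := max_{i,j} |∂f_i/∂x_j(α)| and let L̂ > 0. For each i, j let G_{ij} be a nonempty compact interval with {∂f_i/∂x_j(x) : x ∈ 3B} ⊆ G_{ij} and w(G_{ij}) ≤ 3·L̂·w. If 3·n·n!·L̂·(U + 3L̂w)^{n−1}·w < |det J(α)|, then every n×n real matrix M with M_{ij} ∈ G_{ij} for all i, j satisfies det M ≠ 0 (i.e., the interval Jacobian test succeeds on B). -/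

import Mathlib

/-- The partial derivative `∂f_i/∂x_j` at `x`. -/
noncomputable def pd (n : ℕ) (f : (Fin n → ℝ) → (Fin n → ℝ)) (i j : Fin n)
    (x : Fin n → ℝ) : ℝ :=
  fderiv ℝ (fun y => f y i) x (Pi.single j 1)

/-- The Jacobian matrix of `f` at `x`. -/
noncomputable def Jmat (n : ℕ) (f : (Fin n → ℝ) → (Fin n → ℝ))
    (x : Fin n → ℝ) : Matrix (Fin n) (Fin n) ℝ :=
  fun i j => pd n f i j x

/-- The box of width `w` centered at `c`. -/
def box (n : ℕ) (c : Fin n → ℝ) (w : ℝ) : Set (Fin n → ℝ) :=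
  Set.Icc (fun i => c i - w / 2) (fun i => c i + w / 2)

/-- If `a` and `b` are bounded by `K` and differ entrywise by at most `d`, their products differ
by at most `card ι * K ^ (card ι - 1) * d`. -/
theorem abs_prod_sub_prod_le {ι : Type*} [Fintype ι] {a b : ι → ℝ} {K d : ℝ}
    (hK : 0 ≤ K) (hd : 0 ≤ d) (ha : ∀ i, |a i| ≤ K) (hb : ∀ i, |b i| ≤ K)
    (hab : ∀ i, |a i - b i| ≤ d) :
    |∏ i, a i - ∏ i, b i| ≤ Fintype.card ι * K ^ (Fintype.card ι - 1) * d := by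
  classical
  have h := (MultilinearMap.mkPiAlgebra ℝ ι ℝ).norm_image_sub_le_of_bound zero_le_one
    (fun m => by simp) a b
  simp only [MultilinearMap.mkPiAlgebra_apply, one_mul, Real.norm_eq_abs] at h
  refine h.trans ?_
  have hmax : max ‖a‖ ‖b‖ ≤ K :=
    max_le ((pi_norm_le_iff_of_nonneg hK).2 ha) ((pi_norm_le_iff_of_nonneg hK).2 hb)
  have hdiff : ‖a - b‖ ≤ d := (pi_norm_le_iff_of_nonneg hd).2 hab
  gcongr

/-- Perturbation bound for the determinant of matrices with bounded entries. -/
theorem Matrix.abs_det_sub_det_le {ι : Type*} [Fintype ι] [DecidableEq ι] {A B : Matrix ι ι ℝ}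
    {K d : ℝ} (hK : 0 ≤ K) (hd : 0 ≤ d) (hA : ∀ i j, |A i j| ≤ K) (hB : ∀ i j, |B i j| ≤ K)
    (hAB : ∀ i j, |A i j - B i j| ≤ d) :
    |A.det - B.det| ≤ (Fintype.card ι).factorial *
      (Fintype.card ι * K ^ (Fintype.card ι - 1) * d) := by
  rw [Matrix.det_apply', Matrix.det_apply', ← Finset.sum_sub_distrib]
  refine (Finset.abs_sum_le_sum_abs _ _).trans ?_
  rw [← Fintype.card_perm, ← nsmul_eq_mul, ← Finset.card_univ]
  refine Finset.sum_le_card_nsmul _ _ _ fun σ _ => ?_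
  rw [← mul_sub, abs_mul, abs_unit_intCast, one_mul]
  exact abs_prod_sub_prod_le hK hd (fun _ => hA _ _) (fun _ => hB _ _) (fun _ => hAB _ _)

/-- **Sure success of the interval Jacobian test with Lipschitz box forms.**
Let `α ∈ B` be a simple zero of the `C²` map `f`, `U = max_{i,j} |∂f_i/∂x_j(α)|`,
and `L̂ > 0`.  Suppose each interval `G_{ij} = [GA i j, GB i j]` encloses the
range of `∂f_i/∂x_j` over `3B` and has width at most `3·L̂·w`.  If
`3·n·n!·L̂·(U + 3L̂w)^{n−1}·w < |det J(α)|` then every matrix with entries in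
the `G_{ij}` has nonzero determinant. -/
theorem interval_jacobian_test_sure_success (n : ℕ) (c : Fin n → ℝ) (w : ℝ)
    (hw : 0 < w)
    (f : (Fin n → ℝ) → (Fin n → ℝ)) (hf : ContDiff ℝ 2 f)
    (α : Fin n → ℝ) (hα : α ∈ box n c w)
    (hroot : f α = 0) (hsimple : IsUnit (Jmat n f α))
    (U : ℝ) (hU : U = ⨆ i : Fin n, ⨆ j : Fin n, |pd n f i j α|)
    (L : ℝ) (hL : 0 < L)
    (GA GB : Fin n → Fin n → ℝ)
    (hGle : ∀ i j, GA i j ≤ GB i j)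
    (hGmem : ∀ i j : Fin n, ∀ x ∈ box n c (3 * w),
      pd n f i j x ∈ Set.Icc (GA i j) (GB i j))
    (hGw : ∀ i j, GB i j - GA i j ≤ 3 * L * w)
    (hsmall : 3 * n * (Nat.factorial n : ℝ) * L * (U + 3 * L * w) ^ (n - 1) * w
      < |(Jmat n f α).det|) :
    ∀ M : Matrix (Fin n) (Fin n) ℝ,
      (∀ i j : Fin n, M i j ∈ Set.Icc (GA i j) (GB i j)) → M.det ≠ 0 := by
  intro M hM hdet
  have hα' : α ∈ box n c (3 * w) :=
    ⟨fun i => by linarith [hα.1 i], fun i => by linarith [hα.2 i]⟩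
  have hJU : ∀ i j, |pd n f i j α| ≤ U := fun i j => by
    rw [hU]
    exact (le_ciSup (f := fun j => |pd n f i j α|) (Set.finite_range _).bddAbove j).trans
      (le_ciSup (f := fun i => ⨆ j, |pd n f i j α|) (Set.finite_range _).bddAbove i)
  have hU0 : 0 ≤ U := hU ▸ Real.iSup_nonneg fun _ => Real.iSup_nonneg fun _ => abs_nonneg _
  have hd : 0 ≤ 3 * L * w := by positivity
  have hdiff : ∀ i j, |Jmat n f α i j - M i j| ≤ 3 * L * w := fun i j => by
    have hJ := hGmem i j α hα'
    exact (abs_sub_le_of_le_of_le hJ.1 hJ.2 (hM i j).1 (hM i j).2).trans (hGw i j)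
  have hMU : ∀ i j, |M i j| ≤ U + 3 * L * w := fun i j => by
    have h := abs_sub_abs_le_abs_sub (M i j) (Jmat n f α i j)
    rw [abs_sub_comm] at h
    linarith [hdiff i j, show |Jmat n f α i j| ≤ U from hJU i j]
  have h := Matrix.abs_det_sub_det_le (A := Jmat n f α) (B := M) (add_nonneg hU0 hd) hd
    (fun i j => (hJU i j).trans (le_add_of_nonneg_right hd)) hMU hdiff
  rw [hdet, sub_zero, Fintype.card_fin] at h
  refine hsmall.not_ge (h.trans_eq ?_)
  ring
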